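/- Let M = T × [0,1] with T = ℝ/(2πℤ), let ω₀ ∈ L^∞(M), and let f : ℝ → ℝ be continuous and strictly convex. Let S = { ω ∈ L^∞(M) : ω = Kω₀ almost everywhere for some bistochastic kernel K on M, and E(ω) = E(ω₀) }. Then S is nonempty and there exists ω* ∈ S such that ∫_M f(ω*) dλ = inf_{ω ∈ S} ∫_M f(ω) dλ. -/

import Mathlib

open MeasureTheory ProbabilityTheory

noncomputable section

/-- A bistochastic kernel on a measure space `(X, μ)`. -/
def IsBistochastic {X : Type*} [MeasurableSpace X] (μ : Measure X)
    (κ : Kernel X X) : Prop :=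
  IsMarkovKernel κ ∧ ∀ A : Set X, MeasurableSet A → ∫⁻ x, κ x A ∂μ = μ A

/-- `(Kω)(x) := ∫ ω(y) dκ_x(y)`. -/
def kernApply {X : Type*} [MeasurableSpace X]
    (κ : Kernel X X) (ω : X → ℝ) (x : X) : ℝ :=
  ∫ y, ω y ∂(κ x)

/-- The periodic channel `M = T × [0,1]`, `T = ℝ/(2πℤ)`, represented as the
fundamental domain `(0, 2π] × [0,1]` in `ℝ²`. -/
def channel : Set (ℝ × ℝ) := Set.Ioc 0 (2 * Real.pi) ×ˢ Set.Icc (0:ℝ) 1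

/-- Lebesgue measure on the channel. -/
def μM : Measure (ℝ × ℝ) := volume.restrict channel

/-- The `k`-th Fourier coefficient in the periodic variable `x₁`. -/
def fourierCoef (ω : ℝ × ℝ → ℝ) (k : ℤ) (y : ℝ) : ℂ :=
  (1 / (2 * Real.pi)) * ∫ x₁ in (0:ℝ)..(2 * Real.pi),
    Complex.exp (-(Complex.I * k * x₁)) * (ω (x₁, y) : ℂ)

/-- The Green kernels of the channel with Dirichlet boundary conditions. -/
def green (k : ℤ) (y z : ℝ) : ℝ :=
  if k = 0 then -(min y z * (1 - max y z))
  else -(Real.sinh (k * min y z) * Real.sinh (k * (1 - max y z)) / (k * Real.sinh k))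

/-- The (Dirichlet) kinetic energy. -/
def energy (ω : ℝ × ℝ → ℝ) : ℝ :=
  -Real.pi * ∑' k : ℤ, (∫ y in (0:ℝ)..1, ∫ z in (0:ℝ)..1,
      ((green k y z : ℂ) * fourierCoef ω k y * (starRingEnd ℂ) (fourierCoef ω k z))).re

section Couplings

variable {X Y : Type*} [MeasurableSpace X] [MeasurableSpace Y]

lemma tendsto_of_forall_approx {E : Type*} [PseudoMetricSpace E] {a : ℕ → E} {l : E}
    (h : ∀ ε > 0, ∃ (b : ℕ → E) (m : E), Filter.Tendsto b Filter.atTop (nhds m) ∧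
      (∀ n, dist (a n) (b n) ≤ ε) ∧ dist l m ≤ ε) :
    Filter.Tendsto a Filter.atTop (nhds l) := by
  rw [Metric.tendsto_atTop]
  intro ε hε
  obtain ⟨b, m, hb, hab, hlm⟩ := h (ε / 4) (by positivity)
  obtain ⟨N, hN⟩ := Metric.tendsto_atTop.1 hb (ε / 4) (by positivity)
  refine ⟨N, fun n hn => ?_⟩
  have h1 := dist_triangle4 (a n) (b n) m l
  have h2 := hN n hn
  have h3 := hab n
  rw [dist_comm] at hlm
  linarith

lemma ae_snd_of_map_snd {γ : Measure (X × Y)} {Q : Measure Y} (hγ : γ.map Prod.snd = Q)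
    {p : Y → Prop} (hp : ∀ᵐ y ∂Q, p y) : ∀ᵐ z ∂γ, p z.2 := by
  subst hγ
  exact ae_of_ae_map measurable_snd.aemeasurable hp

lemma integrable_mul_of_coupling {γ : Measure (X × Y)} {P : Measure X} {Q : Measure Y}
    (h₁ : γ.map Prod.fst = P) (h₂ : γ.map Prod.snd = Q)
    {φ : X → ℂ} {ψ : Y → ℂ} {C : ℝ} (hφ : Integrable φ P)
    (hψ : AEStronglyMeasurable ψ Q) (hC : ∀ᵐ y ∂Q, ‖ψ y‖ ≤ C) :
    Integrable (fun z => φ z.1 * ψ z.2) γ := by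
  refine Integrable.mul_bdd (c := C) ?_ ?_ (ae_snd_of_map_snd h₂ hC)
  · subst h₁
    exact hφ.comp_measurable measurable_fst
  · subst h₂
    exact hψ.comp_measurable measurable_snd

lemma norm_integral_mul_le_of_coupling {γ : Measure (X × Y)} {P : Measure X} {Q : Measure Y}
    (h₁ : γ.map Prod.fst = P) (h₂ : γ.map Prod.snd = Q)
    {φ : X → ℂ} {ψ : Y → ℂ} {C : ℝ} (hφ : Integrable φ P) (hC : ∀ᵐ y ∂Q, ‖ψ y‖ ≤ C) :
    ‖∫ z, φ z.1 * ψ z.2 ∂γ‖ ≤ C * ∫ x, ‖φ x‖ ∂P := by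
  have hi : Integrable (fun z : X × Y => ‖φ z.1‖) γ := by
    subst h₁
    exact (hφ.comp_measurable measurable_fst).norm
  calc ‖∫ z, φ z.1 * ψ z.2 ∂γ‖ ≤ ∫ z, C * ‖φ z.1‖ ∂γ := by
        refine norm_integral_le_of_norm_le (hi.const_mul C) ?_
        filter_upwards [ae_snd_of_map_snd h₂ hC] with z hz
        rw [norm_mul, mul_comm]
        gcongr
    _ = C * ∫ x, ‖φ x‖ ∂P := by
        rw [integral_const_mul]
        subst h₁
        rw [integral_map measurable_fst.aemeasurable hφ.1.norm]

lemma norm_integral_mul_le_of_coupling_right {γ : Measure (X × Y)} {P : Measure X} {Q : Measure Y}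
    (h₁ : γ.map Prod.fst = P) (h₂ : γ.map Prod.snd = Q)
    {φ : X → ℂ} {ψ : Y → ℂ} {C : ℝ} (hψ : Integrable ψ Q) (hC : ∀ᵐ x ∂P, ‖φ x‖ ≤ C) :
    ‖∫ z, φ z.1 * ψ z.2 ∂γ‖ ≤ C * ∫ y, ‖ψ y‖ ∂Q := by
  have hi : Integrable (fun z : X × Y => ‖ψ z.2‖) γ := by
    subst h₂
    exact (hψ.comp_measurable measurable_snd).norm
  calc ‖∫ z, φ z.1 * ψ z.2 ∂γ‖ ≤ ∫ z, C * ‖ψ z.2‖ ∂γ := by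
        refine norm_integral_le_of_norm_le (hi.const_mul C) ?_
        have : ∀ᵐ z ∂γ, ‖φ z.1‖ ≤ C := by
          subst h₁
          exact ae_of_ae_map measurable_fst.aemeasurable hC
        filter_upwards [this] with z hz
        rw [norm_mul]
        gcongr
    _ = C * ∫ y, ‖ψ y‖ ∂Q := by
        rw [integral_const_mul]
        subst h₂
        rw [integral_map measurable_snd.aemeasurable hψ.1.norm]

/-- Along a weakly convergent sequence of couplings with fixed marginals, integrals of products
`φ ⊗ ψ` converge for `φ` integrable and `ψ` essentially bounded. -/
lemma tendsto_integral_mul_of_coupling [TopologicalSpace X] [TopologicalSpace Y]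
    [TopologicalSpace.MetrizableSpace X] [TopologicalSpace.MetrizableSpace Y]
    [SecondCountableTopology X] [SecondCountableTopology Y] [BorelSpace X] [BorelSpace Y]
    {P : Measure X} {Q : Measure Y} [IsProbabilityMeasure P] [IsProbabilityMeasure Q]
    {γ : ℕ → ProbabilityMeasure (X × Y)} {γ' : ProbabilityMeasure (X × Y)}
    (h₁ : ∀ n, (γ n : Measure (X × Y)).map Prod.fst = P)
    (h₂ : ∀ n, (γ n : Measure (X × Y)).map Prod.snd = Q)
    (h₁' : (γ' : Measure (X × Y)).map Prod.fst = P)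
    (h₂' : (γ' : Measure (X × Y)).map Prod.snd = Q)
    (hlim : Filter.Tendsto γ Filter.atTop (nhds γ'))
    {φ : X → ℂ} {ψ : Y → ℂ} {C : ℝ} (hφ : Integrable φ P)
    (hψ : AEStronglyMeasurable ψ Q) (hC : ∀ᵐ y ∂Q, ‖ψ y‖ ≤ C) :
    Filter.Tendsto (fun n => ∫ z, φ z.1 * ψ z.2 ∂(γ n : Measure (X × Y))) Filter.atTop
      (nhds (∫ z, φ z.1 * ψ z.2 ∂(γ' : Measure (X × Y)))) := by
  have hC0 : 0 ≤ C := by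
    obtain ⟨y, hy⟩ := hC.exists
    exact (norm_nonneg _).trans hy
  have hψi : Integrable ψ Q := Integrable.of_bound hψ C hC
  refine tendsto_of_forall_approx fun ε hε => ?_
  obtain ⟨g, hg, hgi⟩ := hφ.exists_boundedContinuous_integral_sub_le
    (ε := ε / (2 * (C + 1))) (by positivity)
  obtain ⟨k, hk, hki⟩ := hψi.exists_boundedContinuous_integral_sub_le
    (ε := ε / (2 * (‖g‖ + 1))) (by positivity)
  have key : ∀ σ : Measure (X × Y), σ.map Prod.fst = P → σ.map Prod.snd = Q →
      dist (∫ z, φ z.1 * ψ z.2 ∂σ) (∫ z, g z.1 * k z.2 ∂σ) ≤ ε := by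
    intro σ hσ₁ hσ₂
    have i1 := integrable_mul_of_coupling hσ₁ hσ₂ hφ hψ hC
    have i2 := integrable_mul_of_coupling hσ₁ hσ₂ hgi hψ hC
    have i3 := integrable_mul_of_coupling hσ₁ hσ₂ hgi hki.1
      (Filter.Eventually.of_forall fun y => k.norm_coe_le_norm y)
    have e1 : (∫ z, φ z.1 * ψ z.2 ∂σ) - (∫ z, g z.1 * k z.2 ∂σ) =
        (∫ z, (φ z.1 - g z.1) * ψ z.2 ∂σ) + ∫ z, g z.1 * (ψ z.2 - k z.2) ∂σ := by
      simp only [sub_mul, mul_sub]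
      rw [integral_sub i1 i2, integral_sub i2 i3]
      ring
    have b1 := norm_integral_mul_le_of_coupling hσ₁ hσ₂ (hφ.sub hgi) hC
    have b2 := norm_integral_mul_le_of_coupling_right hσ₁ hσ₂ (φ := g) (hψi.sub hki)
      (Filter.Eventually.of_forall fun x => g.norm_coe_le_norm x)
    have c1 : C * ∫ x, ‖φ x - g x‖ ∂P ≤ ε / 2 := by
      calc C * ∫ x, ‖φ x - g x‖ ∂P ≤ (C + 1) * (ε / (2 * (C + 1))) := by
            gcongr
            linarith
        _ = ε / 2 := by field_simp
    have c2 : ‖g‖ * ∫ y, ‖ψ y - k y‖ ∂Q ≤ ε / 2 := by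
      calc ‖g‖ * ∫ y, ‖ψ y - k y‖ ∂Q ≤ (‖g‖ + 1) * (ε / (2 * (‖g‖ + 1))) := by
            gcongr
            linarith
        _ = ε / 2 := by field_simp
    rw [dist_eq_norm, e1]
    refine (norm_add_le _ _).trans ?_
    simp only [Pi.sub_apply] at b1 b2
    linarith
  let F : BoundedContinuousFunction (X × Y) ℂ :=
    g.compContinuous ⟨Prod.fst, continuous_fst⟩ * k.compContinuous ⟨Prod.snd, continuous_snd⟩
  exact ⟨_, _, (ProbabilityMeasure.tendsto_iff_forall_integral_rclike_tendsto ℂ).1 hlim F,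
    fun n => key _ (h₁ n) (h₂ n), key _ h₁' h₂'⟩

/-- Couplings of two fixed marginals are weakly sequentially compact. -/
lemma exists_subseq_tendsto_coupling [TopologicalSpace X] [TopologicalSpace Y]
    [PolishSpace X] [PolishSpace Y] [BorelSpace X] [BorelSpace Y]
    {P : Measure X} {Q : Measure Y} [IsProbabilityMeasure P] [IsProbabilityMeasure Q]
    {γ : ℕ → ProbabilityMeasure (X × Y)}
    (h₁ : ∀ n, (γ n : Measure (X × Y)).map Prod.fst = P)
    (h₂ : ∀ n, (γ n : Measure (X × Y)).map Prod.snd = Q) :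
    ∃ (γ' : ProbabilityMeasure (X × Y)) (s : ℕ → ℕ), StrictMono s ∧
      Filter.Tendsto (γ ∘ s) Filter.atTop (nhds γ') ∧
      (γ' : Measure (X × Y)).map Prod.fst = P ∧ (γ' : Measure (X × Y)).map Prod.snd = Q := by
  have htight : IsTightMeasureSet
      {((μ : ProbabilityMeasure (X × Y)) : Measure (X × Y)) | μ ∈ Set.range γ} := by
    refine IsTightMeasureSet.prodMk ((isTightMeasureSet_singleton (μ := P)).subset ?_)
      ((isTightMeasureSet_singleton (μ := Q)).subset ?_)
    · rintro _ ⟨_, ⟨_, ⟨n, rfl⟩, rfl⟩, rfl⟩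
      exact h₁ n
    · rintro _ ⟨_, ⟨_, ⟨n, rfl⟩, rfl⟩, rfl⟩
      exact h₂ n
  obtain ⟨γ', -, s, hs, hlim⟩ := (isCompact_closure_of_isTightMeasureSet htight).tendsto_subseq
    (fun n => subset_closure (Set.mem_range_self n))
  refine ⟨γ', s, hs, hlim, ?_, ?_⟩
  · have h := ProbabilityMeasure.tendsto_map_of_tendsto_of_continuous _ _ hlim
      (continuous_fst (X := X) (Y := Y))
    have hc : ∀ n, (γ (s n)).map (continuous_fst (X := X) (Y := Y)).measurable.aemeasurable =
        (⟨P, inferInstance⟩ : ProbabilityMeasure X) := fun n => Subtype.ext (h₁ (s n))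
    simp only [Function.comp_apply, hc] at h
    have e := tendsto_nhds_unique h tendsto_const_nhds
    exact congrArg (fun ν : ProbabilityMeasure X => (ν : Measure X)) e
  · have h := ProbabilityMeasure.tendsto_map_of_tendsto_of_continuous _ _ hlim
      (continuous_snd (X := X) (Y := Y))
    have hc : ∀ n, (γ (s n)).map (continuous_snd (X := X) (Y := Y)).measurable.aemeasurable =
        (⟨Q, inferInstance⟩ : ProbabilityMeasure Y) := fun n => Subtype.ext (h₂ (s n))
    simp only [Function.comp_apply, hc] at h
    have e := tendsto_nhds_unique h tendsto_const_nhds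
    exact congrArg (fun ν : ProbabilityMeasure Y => (ν : Measure Y)) e

end Couplings

section Bistochastic

variable {X : Type*} [MeasurableSpace X]

lemma IsBistochastic.smul {μ : Measure X} {κ : Kernel X X} (h : IsBistochastic μ κ)
    (c : ENNReal) : IsBistochastic (c • μ) κ :=
  ⟨h.1, fun A hA => by rw [lintegral_smul_measure, h.2 A hA, Measure.smul_apply]⟩

lemma isBistochastic_id (μ : Measure X) : IsBistochastic μ Kernel.id := by
  refine ⟨inferInstance, fun A hA => ?_⟩
  simp only [Kernel.id_apply, Measure.dirac_apply' _ hA]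
  exact lintegral_indicator_one hA

lemma IsBistochastic.snd_compProd {μ : Measure X} [SFinite μ] {κ : Kernel X X}
    (h : IsBistochastic μ κ) : (μ ⊗ₘ κ).map Prod.snd = μ := by
  have := h.1
  ext A hA
  rw [Measure.map_apply measurable_snd hA, ← Set.univ_prod,
    Measure.compProd_apply_prod MeasurableSet.univ hA, Measure.restrict_univ, h.2 A hA]

lemma fst_compProd_map {μ : Measure X} [SFinite μ] {κ : Kernel X X} [IsMarkovKernel κ] :
    (μ ⊗ₘ κ).map Prod.fst = μ := Measure.fst_compProd μ κ

lemma IsBistochastic.ae_ae {μ : Measure X} [SFinite μ] {κ : Kernel X X}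
    (h : IsBistochastic μ κ) {p : X → Prop} (hp : ∀ᵐ y ∂μ, p y) :
    ∀ᵐ x ∂μ, ∀ᵐ y ∂(κ x), p y := by
  have := h.1
  exact Measure.ae_ae_of_ae_compProd (p := fun z : X × X => p z.2)
    (ae_snd_of_map_snd h.snd_compProd hp)

lemma IsBistochastic.ae_abs_kernApply_le {μ : Measure X} [SFinite μ] {κ : Kernel X X}
    (h : IsBistochastic μ κ) {ω : X → ℝ} {C : ℝ} (hC : ∀ᵐ y ∂μ, |ω y| ≤ C) :
    ∀ᵐ x ∂μ, |kernApply κ ω x| ≤ C := by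
  have := h.1
  filter_upwards [h.ae_ae hC] with x hx
  simpa [kernApply] using norm_integral_le_of_norm_le_const (μ := κ x) (f := ω) (C := C) hx

lemma IsBistochastic.aestronglyMeasurable_kernApply {μ : Measure X} [SFinite μ] {κ : Kernel X X}
    (h : IsBistochastic μ κ) {ω : X → ℝ} (hω : AEStronglyMeasurable ω μ) :
    AEStronglyMeasurable (kernApply κ ω) μ := by
  have := h.1
  refine ⟨fun x => ∫ y, hω.mk ω y ∂(κ x), ?_, ?_⟩
  · exact hω.stronglyMeasurable_mk.integral_kernel
  · filter_upwards [h.ae_ae hω.ae_eq_mk] with x hx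
    exact integral_congr_ae hx

lemma IsBistochastic.memLp_top_kernApply {μ : Measure X} [SFinite μ] {κ : Kernel X X}
    (h : IsBistochastic μ κ) {ω : X → ℝ} (hω : AEStronglyMeasurable ω μ) {C : ℝ}
    (hC : ∀ᵐ y ∂μ, |ω y| ≤ C) : MemLp (kernApply κ ω) ⊤ μ :=
  memLp_top_of_bound (h.aestronglyMeasurable_kernApply hω) C (h.ae_abs_kernApply_le hC)

lemma IsBistochastic.integral_compProd_mul {μ : Measure X} [SFinite μ] {κ : Kernel X X}
    (h : IsBistochastic μ κ) {ω : X → ℝ} (hω : AEStronglyMeasurable ω μ) {C : ℝ}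
    (hC : ∀ᵐ y ∂μ, |ω y| ≤ C) {φ : X → ℂ} (hφ : Integrable φ μ) :
    ∫ z, φ z.1 * (ω z.2 : ℂ) ∂(μ ⊗ₘ κ) = ∫ x, φ x * (kernApply κ ω x : ℂ) ∂μ := by
  have := h.1
  have hi := integrable_mul_of_coupling fst_compProd_map h.snd_compProd hφ
    (ψ := fun y => (ω y : ℂ)) (Complex.continuous_ofReal.comp_aestronglyMeasurable hω)
    (C := C) (by simpa using hC)
  rw [Measure.integral_compProd hi]
  refine integral_congr_ae (Filter.Eventually.of_forall fun x => ?_)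
  simp only [kernApply]
  rw [integral_const_mul, integral_complex_ofReal]

lemma exists_bistochastic_limit_of_isProbabilityMeasure [TopologicalSpace X] [PolishSpace X]
    [BorelSpace X] {P : Measure X} [IsProbabilityMeasure P] {κ : ℕ → Kernel X X}
    (hκ : ∀ n, IsBistochastic P (κ n)) {ω : X → ℝ} (hω : AEStronglyMeasurable ω P) {C : ℝ}
    (hC : ∀ᵐ y ∂P, |ω y| ≤ C) :
    ∃ (κ' : Kernel X X) (s : ℕ → ℕ), StrictMono s ∧ IsBistochastic P κ' ∧
      ∀ φ : X → ℂ, Integrable φ P → Filter.Tendsto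
        (fun n => ∫ x, φ x * (kernApply (κ (s n)) ω x : ℂ) ∂P) Filter.atTop
        (nhds (∫ x, φ x * (kernApply κ' ω x : ℂ) ∂P)) := by
  have hM := fun n => (hκ n).1
  have : Nonempty X := nonempty_of_isProbabilityMeasure P
  let γ : ℕ → ProbabilityMeasure (X × X) := fun n => ⟨P ⊗ₘ κ n, inferInstance⟩
  have h₁ : ∀ n, (γ n : Measure (X × X)).map Prod.fst = P := fun n => fst_compProd_map
  have h₂ : ∀ n, (γ n : Measure (X × X)).map Prod.snd = P := fun n => (hκ n).snd_compProd
  obtain ⟨γ', s, hs, hlim, h₁', h₂'⟩ := exists_subseq_tendsto_coupling h₁ h₂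
  have hdis : P ⊗ₘ (γ' : Measure (X × X)).condKernel = γ' := by
    have h := (γ' : Measure (X × X)).disintegrate (γ' : Measure (X × X)).condKernel
    rwa [Measure.fst, h₁'] at h
  have hb : IsBistochastic P (γ' : Measure (X × X)).condKernel := by
    refine ⟨inferInstance, fun A hA => ?_⟩
    rw [← setLIntegral_univ, ← Measure.compProd_apply_prod MeasurableSet.univ hA, hdis,
      Set.univ_prod, ← Measure.map_apply measurable_snd hA, h₂']
  refine ⟨_, s, hs, hb, fun φ hφ => ?_⟩
  have h := tendsto_integral_mul_of_coupling (fun n => h₁ (s n)) (fun n => h₂ (s n)) h₁' h₂'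
    hlim hφ (ψ := fun y => (ω y : ℂ)) (Complex.continuous_ofReal.comp_aestronglyMeasurable hω)
    (C := C) (by simpa using hC)
  rw [← hb.integral_compProd_mul hω hC hφ, hdis]
  simp only [← (hκ _).integral_compProd_mul hω hC hφ]
  exact h

/-- Weak sequential compactness of the orbit of an essentially bounded function under bistochastic
kernels. -/
lemma exists_bistochastic_limit [TopologicalSpace X] [PolishSpace X] [BorelSpace X]
    {μ : Measure X} [IsFiniteMeasure μ] [NeZero μ] {κ : ℕ → Kernel X X}
    (hκ : ∀ n, IsBistochastic μ (κ n)) {ω : X → ℝ} (hω : AEStronglyMeasurable ω μ) {C : ℝ}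
    (hC : ∀ᵐ y ∂μ, |ω y| ≤ C) :
    ∃ (κ' : Kernel X X) (s : ℕ → ℕ), StrictMono s ∧ IsBistochastic μ κ' ∧
      ∀ φ : X → ℂ, Integrable φ μ → Filter.Tendsto
        (fun n => ∫ x, φ x * (kernApply (κ (s n)) ω x : ℂ) ∂μ) Filter.atTop
        (nhds (∫ x, φ x * (kernApply κ' ω x : ℂ) ∂μ)) := by
  have h0 : μ Set.univ ≠ 0 := NeZero.ne _
  have ht : μ Set.univ ≠ ⊤ := measure_ne_top _ _
  have hinv : μ Set.univ • ((μ Set.univ)⁻¹ • μ) = μ := by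
    rw [smul_smul, ENNReal.mul_inv_cancel h0 ht, one_smul]
  obtain ⟨κ', s, hs, hb, hlim⟩ := exists_bistochastic_limit_of_isProbabilityMeasure
    (fun n => (hκ n).smul (μ Set.univ)⁻¹) (hω.smul_measure _)
    (Measure.ae_smul_measure hC (μ Set.univ)⁻¹)
  refine ⟨κ', s, hs, ?_, fun φ hφ => ?_⟩
  · simpa only [hinv] using hb.smul (μ Set.univ)
  · have h := (hlim φ (hφ.smul_measure (ENNReal.inv_ne_top.2 h0))).const_smul (μ Set.univ).toReal
    simpa only [← integral_smul_measure, hinv] using h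

end Bistochastic

section Convex

open Set

lemma ConvexOn.add_rightDeriv_mul_sub_le {f : ℝ → ℝ} (hf : ConvexOn ℝ univ f) (a b : ℝ) :
    f a + derivWithin f (Ioi a) a * (b - a) ≤ f b := by
  have ha : a ∈ interior (univ : Set ℝ) := by simp
  rcases lt_trichotomy a b with h | rfl | h
  · have h1 := hf.rightDeriv_le_slope_of_mem_interior ha (mem_univ b) h
    rw [slope_def_field, le_div_iff₀ (sub_pos.2 h)] at h1
    linarith
  · simp
  · have h1 := (hf.slope_le_leftDeriv_of_mem_interior (mem_univ b) ha h).trans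
      (hf.leftDeriv_le_rightDeriv_of_mem_interior ha)
    rw [slope_def_field, div_le_iff₀ (sub_pos.2 h)] at h1
    linarith

lemma ConvexOn.monotone_rightDeriv {f : ℝ → ℝ} (hf : ConvexOn ℝ univ f) :
    Monotone fun x => derivWithin f (Ioi x) x := by
  simpa [monotoneOn_univ] using hf.monotoneOn_rightDeriv

variable {X : Type*} [MeasurableSpace X] {μ : Measure X} [IsFiniteMeasure μ]

lemma integrable_comp_of_ae_abs_le {f : ℝ → ℝ} (hf : Continuous f) {ω : X → ℝ}
    (hω : AEStronglyMeasurable ω μ) {C : ℝ} (hC : ∀ᵐ x ∂μ, |ω x| ≤ C) :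
    Integrable (fun x => f (ω x)) μ := by
  obtain ⟨B, hB⟩ := (isCompact_Icc (a := -C) (b := C)).exists_bound_of_continuousOn hf.continuousOn
  refine Integrable.of_bound (hf.comp_aestronglyMeasurable hω) B ?_
  filter_upwards [hC] with x hx
  exact hB _ (abs_le.1 hx)

/-- Convex integral functionals are weakly sequentially lower semicontinuous. -/
lemma integral_comp_le_of_weak_limit {f : ℝ → ℝ} (hf : Continuous f) (hconv : ConvexOn ℝ univ f)
    {ω : ℕ → X → ℝ} {ω' : X → ℝ} {C : ℝ} (hω : ∀ n, AEStronglyMeasurable (ω n) μ)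
    (hω' : AEStronglyMeasurable ω' μ) (hC : ∀ n, ∀ᵐ x ∂μ, |ω n x| ≤ C)
    (hC' : ∀ᵐ x ∂μ, |ω' x| ≤ C)
    (hlim : ∀ φ : X → ℂ, Integrable φ μ → Filter.Tendsto
      (fun n => ∫ x, φ x * (ω n x : ℂ) ∂μ) Filter.atTop (nhds (∫ x, φ x * (ω' x : ℂ) ∂μ)))
    {m : ℝ} (hm : Filter.Tendsto (fun n => ∫ x, f (ω n x) ∂μ) Filter.atTop (nhds m)) :
    ∫ x, f (ω' x) ∂μ ≤ m := by
  set p : ℝ → ℝ := fun x => derivWithin f (Ioi x) x with hp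
  have hpm : Monotone p := hconv.monotone_rightDeriv
  have hpi : Integrable (fun x => p (ω' x)) μ := by
    refine Integrable.of_bound
      (hpm.measurable.comp_aemeasurable hω'.aemeasurable).aestronglyMeasurable
      (max |p (-C)| |p C|) ?_
    filter_upwards [hC'] with x hx
    exact abs_le_max_abs_abs (hpm (abs_le.1 hx).1) (hpm (abs_le.1 hx).2)
  have hmul : ∀ {η : X → ℝ}, AEStronglyMeasurable η μ → (∀ᵐ x ∂μ, |η x| ≤ C) →
      Integrable (fun x => p (ω' x) * η x) μ := fun hη hηC => hpi.mul_bdd (c := C) hη hηC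
  have hreal : Filter.Tendsto (fun n => ∫ x, p (ω' x) * ω n x ∂μ) Filter.atTop
      (nhds (∫ x, p (ω' x) * ω' x ∂μ)) := by
    have h := hlim (fun x => (p (ω' x) : ℂ)) hpi.ofReal
    simp only [← Complex.ofReal_mul, integral_complex_ofReal] at h
    exact Complex.continuous_re.continuousAt.tendsto.comp h
  have hbound : ∀ n, ∫ x, f (ω' x) ∂μ + (∫ x, p (ω' x) * ω n x ∂μ - ∫ x, p (ω' x) * ω' x ∂μ)
      ≤ ∫ x, f (ω n x) ∂μ := by
    intro n
    have i1 := integrable_comp_of_ae_abs_le hf hω' hC'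
    have i2 := hmul (hω n) (hC n)
    have i3 := hmul hω' hC'
    have i4 : Integrable (fun x => p (ω' x) * ω n x - p (ω' x) * ω' x) μ := i2.sub i3
    rw [← integral_sub i2 i3, ← integral_add i1 i4]
    refine integral_mono (i1.add i4) (integrable_comp_of_ae_abs_le hf (hω n) (hC n)) ?_
    intro x
    have := hconv.add_rightDeriv_mul_sub_le (ω' x) (ω n x)
    simp only [hp]
    linarith
  have hL := ((hreal.sub_const (∫ x, p (ω' x) * ω' x ∂μ)).const_add (∫ x, f (ω' x) ∂μ))
  rw [sub_self, add_zero] at hL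
  exact le_of_tendsto_of_tendsto' hL hm hbound

end Convex

section Green

open Set

lemma sinh_mul_sinh_le {A B D : ℝ} (hA : 0 ≤ A) (hB : 0 ≤ B) (hD : 0 ≤ D) :
    Real.sinh A * Real.sinh B ≤ Real.sinh (A + B + D) * Real.exp (-D) / 2 := by
  have h1 : Real.sinh (A + B) ≤ Real.sinh (A + B + D) * Real.exp (-D) := by
    have e1 : Real.exp (A + B + D) * Real.exp (-D) = Real.exp (A + B) := by
      rw [← Real.exp_add]; ring_nf
    have e2 : Real.exp (-(A + B + D)) * Real.exp (-D) ≤ Real.exp (-(A + B)) := by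
      rw [← Real.exp_add]
      exact Real.exp_le_exp.2 (by linarith)
    rw [Real.sinh_eq, Real.sinh_eq]
    linarith
  have h2 : 2 * (Real.sinh A * Real.sinh B) ≤ Real.sinh (A + B) := by
    rw [Real.sinh_add]
    have a0 := Real.sinh_nonneg_iff.2 hA
    have b0 := Real.sinh_nonneg_iff.2 hB
    have a1 := mul_le_mul_of_nonneg_right (Real.sinh_lt_cosh A).le b0
    have b1 := mul_le_mul_of_nonneg_left (Real.sinh_lt_cosh B).le a0
    linarith
  linarith

lemma abs_green_le_exp {k : ℤ} (hk : k ≠ 0) {y z : ℝ} (hy : y ∈ Icc (0 : ℝ) 1)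
    (hz : z ∈ Icc (0 : ℝ) 1) :
    |green k y z| ≤ Real.exp (-(|(k : ℝ)| * |y - z|)) / (2 * |(k : ℝ)|) := by
  have hk0 : (k : ℝ) ≠ 0 := by exact_mod_cast hk
  have heven : green k y z = -(Real.sinh (|(k : ℝ)| * min y z) *
      Real.sinh (|(k : ℝ)| * (1 - max y z)) / (|(k : ℝ)| * Real.sinh |(k : ℝ)|)) := by
    rw [green, if_neg hk]
    rcases abs_choice (k : ℝ) with h | h <;> rw [h]
    simp only [neg_mul, Real.sinh_neg, mul_neg, neg_neg]
  have ht : 0 < |(k : ℝ)| := abs_pos.2 hk0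
  rw [heven, abs_neg]
  generalize |(k : ℝ)| = t at ht ⊢
  have hm : 0 ≤ min y z := le_min hy.1 hz.1
  have hM : 0 ≤ 1 - max y z := sub_nonneg.2 (max_le hy.2 hz.2)
  have hs : 0 < Real.sinh t := Real.sinh_pos_iff.2 ht
  have h := sinh_mul_sinh_le (mul_nonneg ht.le hm) (mul_nonneg ht.le hM)
    (mul_nonneg ht.le (abs_nonneg (y - z)))
  have hsum : t * min y z + t * (1 - max y z) + t * |y - z| = t := by
    rw [← max_sub_min_eq_abs']
    ring
  rw [hsum] at h
  rw [abs_of_nonneg (div_nonneg (mul_nonneg (Real.sinh_nonneg_iff.2 (mul_nonneg ht.le hm))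
    (Real.sinh_nonneg_iff.2 (mul_nonneg ht.le hM))) (mul_pos ht hs).le),
    div_le_div_iff₀ (mul_pos ht hs) (by positivity)]
  calc _ ≤ (Real.sinh t * Real.exp (-(t * |y - z|)) / 2) * (2 * t) := by gcongr
    _ = _ := by ring

lemma abs_green_le_one (k : ℤ) {y z : ℝ} (hy : y ∈ Icc (0 : ℝ) 1) (hz : z ∈ Icc (0 : ℝ) 1) :
    |green k y z| ≤ 1 := by
  by_cases hk : k = 0
  · have hm : 0 ≤ min y z := le_min hy.1 hz.1
    have hm1 : min y z ≤ 1 := (min_le_left _ _).trans hy.2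
    have hM : 0 ≤ 1 - max y z := sub_nonneg.2 (max_le hy.2 hz.2)
    have hM1 : 1 - max y z ≤ 1 := by linarith [le_max_left y z, hy.1]
    rw [green, if_pos hk, abs_neg, abs_of_nonneg (mul_nonneg hm hM)]
    exact mul_le_one₀ hm1 hM hM1
  · refine (abs_green_le_exp hk hy hz).trans ?_
    have h1 : (1 : ℝ) ≤ |(k : ℝ)| := by exact_mod_cast Int.one_le_abs hk
    rw [div_le_one (by positivity)]
    have : Real.exp (-(|(k : ℝ)| * |y - z|)) ≤ 1 := Real.exp_le_one_iff.2 (by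
      have := mul_nonneg (abs_nonneg (k : ℝ)) (abs_nonneg (y - z))
      linarith)
    linarith

lemma continuous_green (k : ℤ) : Continuous fun p : ℝ × ℝ => green k p.1 p.2 := by
  by_cases hk : k = 0
  · simp only [green, if_pos hk]
    fun_prop
  · simp only [green, if_neg hk]
    fun_prop

lemma integral_exp_neg_mul_abs_sub_le {a y : ℝ} (ha : 0 < a) (hy : y ∈ Icc (0 : ℝ) 1) :
    ∫ z in (0 : ℝ)..1, Real.exp (-(a * |y - z|)) ≤ 2 / a := by
  have hcont : Continuous fun z : ℝ => Real.exp (-(a * |y - z|)) := by fun_prop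
  have hleft : ∫ z in (0 : ℝ)..y, Real.exp (-(a * |y - z|)) ≤ 1 / a := by
    have hd : ∀ z ∈ uIcc 0 y, HasDerivAt (fun z => Real.exp (-(a * (y - z))) / a)
        (Real.exp (-(a * |y - z|))) z := by
      intro z hz
      rw [uIcc_of_le hy.1] at hz
      rw [abs_of_nonneg (sub_nonneg.2 hz.2)]
      have h := ((((hasDerivAt_id z).const_sub y).const_mul a).neg.exp).div_const a
      refine h.congr_deriv ?_
      simp only [Pi.neg_apply, id]
      field_simp
    rw [intervalIntegral.integral_eq_sub_of_hasDerivAt hd (hcont.intervalIntegrable _ _),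
      ← sub_div]
    gcongr
    simp only [sub_self, mul_zero, neg_zero, Real.exp_zero]
    linarith [Real.exp_pos (-(a * (y - 0)))]
  have hright : ∫ z in y..1, Real.exp (-(a * |y - z|)) ≤ 1 / a := by
    have hd : ∀ z ∈ uIcc y 1, HasDerivAt (fun z => -(Real.exp (-(a * (z - y))) / a))
        (Real.exp (-(a * |y - z|))) z := by
      intro z hz
      rw [uIcc_of_le hy.2] at hz
      rw [abs_sub_comm, abs_of_nonneg (sub_nonneg.2 hz.1)]
      have h := ((((hasDerivAt_id z).sub_const y).const_mul a).neg.exp).div_const a |>.neg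
      refine h.congr_deriv ?_
      simp only [Pi.neg_apply, id]
      field_simp
    rw [intervalIntegral.integral_eq_sub_of_hasDerivAt hd (hcont.intervalIntegrable _ _),
      neg_sub_neg, ← sub_div]
    gcongr
    simp only [sub_self, mul_zero, neg_zero, Real.exp_zero]
    linarith [Real.exp_pos (-(a * (1 - y)))]
  rw [← intervalIntegral.integral_add_adjacent_intervals (hcont.intervalIntegrable 0 y)
    (hcont.intervalIntegrable y 1)]
  calc _ ≤ 1 / a + 1 / a := add_le_add hleft hright
    _ = 2 / a := by ring

lemma integral_abs_green_le (k : ℤ) {y : ℝ} (hy : y ∈ Icc (0 : ℝ) 1) :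
    ∫ z in (0 : ℝ)..1, |green k y z| ≤ 1 / (k : ℝ) ^ 2 + if k = 0 then 1 else 0 := by
  have hcont : Continuous fun z => |green k y z| :=
    ((continuous_green k).comp (by fun_prop : Continuous fun z : ℝ => (y, z))).abs
  by_cases hk : k = 0
  · calc ∫ z in (0 : ℝ)..1, |green k y z| ≤ ∫ _ in (0 : ℝ)..1, (1 : ℝ) :=
          intervalIntegral.integral_mono_on zero_le_one (hcont.intervalIntegrable _ _)
            intervalIntegrable_const fun z hz => abs_green_le_one k hy hz
      _ = _ := by simp [hk]
  · have ht : 0 < |(k : ℝ)| := abs_pos.2 (by exact_mod_cast hk)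
    calc ∫ z in (0 : ℝ)..1, |green k y z|
        ≤ ∫ z in (0 : ℝ)..1, Real.exp (-(|(k : ℝ)| * |y - z|)) / (2 * |(k : ℝ)|) :=
          intervalIntegral.integral_mono_on zero_le_one (hcont.intervalIntegrable _ _)
            (Continuous.intervalIntegrable (by fun_prop) _ _)
            fun z hz => abs_green_le_exp hk hy hz
      _ ≤ 2 / |(k : ℝ)| / (2 * |(k : ℝ)|) := by
          rw [intervalIntegral.integral_div]
          gcongr
          exact integral_exp_neg_mul_abs_sub_le ht hy
      _ = _ := by
          rw [if_neg hk, add_zero, ← sq_abs (k : ℝ)]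
          field_simp

lemma summable_green_bound :
    Summable fun k : ℤ => 1 / (k : ℝ) ^ 2 + if k = 0 then (1 : ℝ) else 0 :=
  (Real.summable_one_div_int_pow.2 one_lt_two).add (hasSum_ite_eq 0 (1 : ℝ)).summable

end Green

section Energy

open Set Filter

/-- Lebesgue measure on the circle factor. -/
abbrev circleMeasure : Measure ℝ := volume.restrict (Ioc 0 (2 * Real.pi))

/-- Lebesgue measure on the transverse factor. -/
abbrev heightMeasure : Measure ℝ := volume.restrict (Ioc (0 : ℝ) 1)

lemma μM_eq_prod : μM = circleMeasure.prod heightMeasure := by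
  rw [μM, channel, Measure.volume_eq_prod, ← Measure.prod_restrict]
  congr 1
  exact (Measure.restrict_congr_set Ioc_ae_eq_Icc).symm

instance : IsFiniteMeasure μM := by
  rw [μM_eq_prod]
  infer_instance

instance : NeZero μM := by
  refine ⟨fun h => ?_⟩
  have h1 : μM univ = ENNReal.ofReal (2 * Real.pi) := by
    rw [μM_eq_prod, ← univ_prod_univ, Measure.prod_prod]
    simp
  rw [h] at h1
  have := Real.pi_pos
  simp at h1
  linarith

lemma ae_heightMeasure_mem_Icc : ∀ᵐ y ∂heightMeasure, y ∈ Icc (0 : ℝ) 1 := by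
  filter_upwards [ae_restrict_mem measurableSet_Ioc] with y hy
  exact ⟨hy.1.le, hy.2⟩

lemma fourierCoef_eq (ω : ℝ × ℝ → ℝ) (k : ℤ) (y : ℝ) :
    fourierCoef ω k y = ∫ x, (1 / (2 * Real.pi) : ℂ) *
      (Complex.exp (-(Complex.I * k * x)) * (ω (x, y) : ℂ)) ∂circleMeasure := by
  rw [fourierCoef, intervalIntegral.integral_of_le Real.two_pi_pos.le, integral_const_mul]

lemma norm_exp_fourier (k : ℤ) (x : ℝ) : ‖Complex.exp (-(Complex.I * k * x))‖ = 1 := by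
  rw [Complex.norm_exp]
  simp

lemma conj_fourierCoef (ω : ℝ × ℝ → ℝ) (k : ℤ) (y : ℝ) :
    (starRingEnd ℂ) (fourierCoef ω k y) = fourierCoef ω (-k) y := by
  rw [fourierCoef_eq, fourierCoef_eq, ← integral_conj]
  congr 1
  ext x
  simp [← Complex.exp_conj, Complex.conj_ofNat]

variable {ω : ℝ × ℝ → ℝ} {C : ℝ}

lemma ae_norm_fourierCoef_le (hC : ∀ᵐ x ∂μM, |ω x| ≤ C) (k : ℤ) :
    ∀ᵐ y ∂heightMeasure, ‖fourierCoef ω k y‖ ≤ C := by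
  rw [μM_eq_prod] at hC
  rw [← Measure.prod_swap] at hC
  have h := Measure.ae_ae_of_ae_prod (ae_of_ae_map measurable_swap.aemeasurable hC)
  filter_upwards [h] with y hy
  have hpi := Real.two_pi_pos
  have h1 := norm_integral_le_of_norm_le_const (μ := circleMeasure) (C := 1 / (2 * Real.pi) * C)
    (f := fun x : ℝ => (1 / (2 * Real.pi) : ℂ) *
      (Complex.exp (-(Complex.I * k * x)) * (ω (x, y) : ℂ))) (by
      filter_upwards [hy] with x hx
      rw [norm_mul, norm_mul, norm_exp_fourier, one_mul, Complex.norm_real]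
      have e : ‖(1 / (2 * Real.pi) : ℂ)‖ = 1 / (2 * Real.pi) := by
        simp [abs_of_pos Real.pi_pos]
      rw [e]
      gcongr
      exact hx)
  rw [fourierCoef_eq]
  refine h1.trans (le_of_eq ?_)
  have e : circleMeasure.real univ = 2 * Real.pi := by
    simp [Measure.real, Real.pi_pos.le]
  rw [e]
  field_simp

lemma aestronglyMeasurable_fourier_mul (hω : AEStronglyMeasurable ω μM) (k : ℤ) :
    AEStronglyMeasurable (fun x : ℝ × ℝ => (1 / (2 * Real.pi) : ℂ) *
      (Complex.exp (-(Complex.I * k * x.1)) * (ω x : ℂ))) μM := by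
  refine AEStronglyMeasurable.const_mul (AEStronglyMeasurable.mul ?_ ?_) _
  · exact Continuous.aestronglyMeasurable (by fun_prop)
  · exact Complex.continuous_ofReal.comp_aestronglyMeasurable hω

lemma aestronglyMeasurable_fourierCoef (hω : AEStronglyMeasurable ω μM) (k : ℤ) :
    AEStronglyMeasurable (fourierCoef ω k) heightMeasure := by
  have h := aestronglyMeasurable_fourier_mul hω k
  rw [μM_eq_prod] at h
  have e : fourierCoef ω k = fun y => ∫ x, (1 / (2 * Real.pi) : ℂ) *
      (Complex.exp (-(Complex.I * k * x)) * (ω (x, y) : ℂ)) ∂circleMeasure :=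
    funext (fourierCoef_eq ω k)
  rw [e]
  exact h.prod_swap.integral_prod_right'

/-- The test function on the channel dual to the `k`-th Fourier mode with profile `h`. -/
def fourierTest (k : ℤ) (h : ℝ → ℂ) (x : ℝ × ℝ) : ℂ :=
  h x.2 * ((1 / (2 * Real.pi) : ℂ) * Complex.exp (-(Complex.I * k * x.1)))

lemma integrable_fourierTest (k : ℤ) {h : ℝ → ℂ} (hh : Integrable h heightMeasure) :
    Integrable (fourierTest k h) μM := by
  rw [μM_eq_prod]
  refine Integrable.mul_bdd (c := 1 / (2 * Real.pi)) ?_ ?_ ?_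
  · exact hh.comp_snd circleMeasure
  · exact Continuous.aestronglyMeasurable (by fun_prop)
  · refine Eventually.of_forall fun x => ?_
    rw [norm_mul, norm_exp_fourier]
    simp [abs_of_pos Real.pi_pos]

lemma integral_mul_fourierCoef (hω : AEStronglyMeasurable ω μM) (hC : ∀ᵐ x ∂μM, |ω x| ≤ C)
    (k : ℤ) {h : ℝ → ℂ} (hh : Integrable h heightMeasure) :
    ∫ y, h y * fourierCoef ω k y ∂heightMeasure = ∫ x, fourierTest k h x * (ω x : ℂ) ∂μM := by
  have hi : Integrable (fun x => fourierTest k h x * (ω x : ℂ)) μM :=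
    (integrable_fourierTest k hh).mul_bdd (c := C)
      (Complex.continuous_ofReal.comp_aestronglyMeasurable hω) (by simpa using hC)
  rw [μM_eq_prod] at hi ⊢
  rw [integral_prod_symm _ hi]
  refine integral_congr_ae (Eventually.of_forall fun y => ?_)
  simp only [fourierCoef_eq, fourierTest]
  rw [← integral_const_mul]
  congr 1
  ext x
  ring

/-- The `k`-th Fourier mode of the stream function, up to conjugation. -/
def greenPotential (ω : ℝ × ℝ → ℝ) (k : ℤ) (y : ℝ) : ℂ :=
  ∫ z, (green k y z : ℂ) * fourierCoef ω (-k) z ∂heightMeasure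

/-- The contribution of the `k`-th Fourier mode to the energy. -/
def modeEnergy (ω : ℝ × ℝ → ℝ) (k : ℤ) : ℂ :=
  ∫ y, greenPotential ω k y * fourierCoef ω k y ∂heightMeasure

lemma energy_eq (ω : ℝ × ℝ → ℝ) : energy ω = -Real.pi * ∑' k : ℤ, (modeEnergy ω k).re := by
  rw [energy]
  congr 2
  ext k
  congr 1
  rw [modeEnergy, intervalIntegral.integral_of_le zero_le_one]
  congr 1
  ext y
  rw [intervalIntegral.integral_of_le zero_le_one, greenPotential, ← integral_mul_const]
  congr 1
  ext z
  rw [conj_fourierCoef]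
  ring

lemma integrable_green (k : ℤ) (y : ℝ) :
    Integrable (fun z => (green k y z : ℂ)) heightMeasure := by
  have hcont : Continuous fun z => (green k y z : ℂ) :=
    Complex.continuous_ofReal.comp
      ((continuous_green k).comp (by fun_prop : Continuous fun z : ℝ => (y, z)))
  have h := hcont.intervalIntegrable (μ := volume) 0 1
  rwa [intervalIntegrable_iff_integrableOn_Ioc_of_le zero_le_one] at h

lemma aestronglyMeasurable_greenPotential (hω : AEStronglyMeasurable ω μM) (k : ℤ) :
    AEStronglyMeasurable (greenPotential ω k) heightMeasure := by
  have h : AEStronglyMeasurable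
      (fun p : ℝ × ℝ => (green k p.1 p.2 : ℂ) * fourierCoef ω (-k) p.2)
      (heightMeasure.prod heightMeasure) :=
    (Complex.continuous_ofReal.comp (continuous_green k)).aestronglyMeasurable.mul
      (aestronglyMeasurable_fourierCoef hω (-k)).comp_snd
  exact h.integral_prod_right'

lemma norm_greenPotential_le (hC : ∀ᵐ x ∂μM, |ω x| ≤ C) (k : ℤ) {y : ℝ}
    (hy : y ∈ Icc (0 : ℝ) 1) :
    ‖greenPotential ω k y‖ ≤ C * (1 / (k : ℝ) ^ 2 + if k = 0 then 1 else 0) := by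
  have hC0 : 0 ≤ C := by
    obtain ⟨x, hx⟩ := hC.exists
    exact (abs_nonneg _).trans hx
  calc ‖greenPotential ω k y‖ ≤ ∫ z, C * |green k y z| ∂heightMeasure := by
        refine norm_integral_le_of_norm_le ?_ ?_
        · have h := ((integrable_green k y).norm).const_mul C
          simpa using h
        · filter_upwards [ae_norm_fourierCoef_le hC (-k)] with z hz
          rw [norm_mul, Complex.norm_real, Real.norm_eq_abs, mul_comm]
          gcongr
    _ ≤ _ := by
        rw [integral_const_mul, ← intervalIntegral.integral_of_le zero_le_one]
        gcongr
        exact integral_abs_green_le k hy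

lemma integrable_greenPotential (hω : AEStronglyMeasurable ω μM) (hC : ∀ᵐ x ∂μM, |ω x| ≤ C)
    (k : ℤ) : Integrable (greenPotential ω k) heightMeasure :=
  Integrable.of_bound (aestronglyMeasurable_greenPotential hω k) _
    (ae_heightMeasure_mem_Icc.mono fun _ hy => norm_greenPotential_le hC k hy)

lemma norm_modeEnergy_le (hC : ∀ᵐ x ∂μM, |ω x| ≤ C) (k : ℤ) :
    ‖modeEnergy ω k‖ ≤ C * C * (1 / (k : ℝ) ^ 2 + if k = 0 then 1 else 0) := by
  have hC0 : 0 ≤ C := by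
    obtain ⟨x, hx⟩ := hC.exists
    exact (abs_nonneg _).trans hx
  have h := norm_integral_le_of_norm_le_const (μ := heightMeasure)
    (f := fun y => greenPotential ω k y * fourierCoef ω k y)
    (C := C * (1 / (k : ℝ) ^ 2 + if k = 0 then 1 else 0) * C) (by
      filter_upwards [ae_heightMeasure_mem_Icc, ae_norm_fourierCoef_le hC k] with y hy hy'
      rw [norm_mul]
      exact mul_le_mul (norm_greenPotential_le hC k hy) hy' (norm_nonneg _)
        ((norm_nonneg _).trans (norm_greenPotential_le hC k hy)))
  refine h.trans (le_of_eq ?_)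
  have e : heightMeasure.real univ = 1 := by simp [Measure.real]
  rw [e]
  ring

variable {η : ℕ → ℝ × ℝ → ℝ}

lemma tendsto_modeEnergy (hη : ∀ n, AEStronglyMeasurable (η n) μM)
    (hω : AEStronglyMeasurable ω μM) (hηC : ∀ n, ∀ᵐ x ∂μM, |η n x| ≤ C)
    (hC : ∀ᵐ x ∂μM, |ω x| ≤ C)
    (hlim : ∀ φ : ℝ × ℝ → ℂ, Integrable φ μM → Tendsto
      (fun n => ∫ x, φ x * (η n x : ℂ) ∂μM) atTop (nhds (∫ x, φ x * (ω x : ℂ) ∂μM)))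
    (k : ℤ) : Tendsto (fun n => modeEnergy (η n) k) atTop (nhds (modeEnergy ω k)) := by
  have hC0 : 0 ≤ C := by
    obtain ⟨x, hx⟩ := hC.exists
    exact (abs_nonneg _).trans hx
  set B : ℝ := C * (1 / (k : ℝ) ^ 2 + if k = 0 then 1 else 0) with hB
  have hcoef : ∀ (j : ℤ) (h : ℝ → ℂ), Integrable h heightMeasure →
      Tendsto (fun n => ∫ y, h y * fourierCoef (η n) j y ∂heightMeasure) atTop
        (nhds (∫ y, h y * fourierCoef ω j y ∂heightMeasure)) := by
    intro j h hh
    simp only [integral_mul_fourierCoef (hη _) (hηC _) j hh,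
      integral_mul_fourierCoef hω hC j hh]
    exact hlim _ (integrable_fourierTest j hh)
  have hpot : ∀ y, Tendsto (fun n => greenPotential (η n) k y) atTop
      (nhds (greenPotential ω k y)) := fun y => hcoef (-k) _ (integrable_green k y)
  have hgi := integrable_greenPotential hω hC k
  have hgni := fun n => integrable_greenPotential (hη n) (hηC n) k
  have hL1 : Tendsto
      (fun n => ∫ y, ‖greenPotential (η n) k y - greenPotential ω k y‖ ∂heightMeasure) atTop
      (nhds 0) := by
    have h := tendsto_integral_of_dominated_convergence (μ := heightMeasure) (fun _ => B + B)
      (F := fun n y => ‖greenPotential (η n) k y - greenPotential ω k y‖) (f := fun _ => 0)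
      (fun n => ((hgni n).1.sub hgi.1).norm) (integrable_const _)
      (fun n => by
        filter_upwards [ae_heightMeasure_mem_Icc] with y hy
        rw [norm_norm]
        exact (norm_sub_le _ _).trans
          (add_le_add (norm_greenPotential_le (hηC n) k hy) (norm_greenPotential_le hC k hy)))
      (Eventually.of_forall fun y => by
        simpa using ((hpot y).sub_const (greenPotential ω k y)).norm)
    simpa using h
  have hsplit : ∀ n, modeEnergy (η n) k =
      (∫ y, (greenPotential (η n) k y - greenPotential ω k y) * fourierCoef (η n) k y
        ∂heightMeasure) + ∫ y, greenPotential ω k y * fourierCoef (η n) k y ∂heightMeasure := by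
    intro n
    have hm := aestronglyMeasurable_fourierCoef (hη n) k
    have hb := ae_norm_fourierCoef_le (hηC n) k
    have i1 : Integrable (fun y => greenPotential (η n) k y * fourierCoef (η n) k y)
        heightMeasure := (hgni n).mul_bdd hm hb
    have i2 : Integrable (fun y => greenPotential ω k y * fourierCoef (η n) k y)
        heightMeasure := hgi.mul_bdd hm hb
    simp only [sub_mul]
    rw [integral_sub i1 i2, modeEnergy]
    ring
  have hsmall : Tendsto (fun n => ∫ y, (greenPotential (η n) k y - greenPotential ω k y) *
      fourierCoef (η n) k y ∂heightMeasure) atTop (nhds 0) := by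
    refine squeeze_zero_norm (fun n => ?_) (by simpa using hL1.mul_const C)
    rw [← integral_mul_const]
    refine norm_integral_le_of_norm_le ((((hgni n).sub hgi).norm).mul_const C) ?_
    filter_upwards [ae_norm_fourierCoef_le (hηC n) k] with y hy
    rw [norm_mul]
    gcongr
  simp only [hsplit]
  simpa [modeEnergy] using hsmall.add (hcoef k _ hgi)

/-- The energy is sequentially continuous for weak convergence of uniformly bounded functions. -/
lemma tendsto_energy (hη : ∀ n, AEStronglyMeasurable (η n) μM)
    (hω : AEStronglyMeasurable ω μM) (hηC : ∀ n, ∀ᵐ x ∂μM, |η n x| ≤ C)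
    (hC : ∀ᵐ x ∂μM, |ω x| ≤ C)
    (hlim : ∀ φ : ℝ × ℝ → ℂ, Integrable φ μM → Tendsto
      (fun n => ∫ x, φ x * (η n x : ℂ) ∂μM) atTop (nhds (∫ x, φ x * (ω x : ℂ) ∂μM))) :
    Tendsto (fun n => energy (η n)) atTop (nhds (energy ω)) := by
  simp only [energy_eq]
  refine Tendsto.const_mul _ (tendsto_tsum_of_dominated_convergence
    (summable_green_bound.mul_left (C * C)) (fun k => ?_) (Eventually.of_forall fun n k => ?_))
  · exact Complex.continuous_re.continuousAt.tendsto.comp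
      (tendsto_modeEnergy hη hω hηC hC hlim k)
  · exact (Complex.abs_re_le_norm _).trans (norm_modeEnergy_le (hηC n) k)

end Energy

/-- existence of a minimizer of a strictly convex Casimir over
`closure(O_{ω₀})* ∩ {E = E(ω₀)}` on the periodic channel. -/
theorem exists_casimir_minimizer
    (ω₀ : ℝ × ℝ → ℝ) (hω₀ : MemLp ω₀ ⊤ μM)
    (f : ℝ → ℝ) (hfc : Continuous f) (hfconv : StrictConvexOn ℝ Set.univ f)
    (S : Set ((ℝ × ℝ) → ℝ))
    (hS : S = {ω | MemLp ω ⊤ μM ∧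
        (∃ κ : Kernel (ℝ × ℝ) (ℝ × ℝ), IsBistochastic μM κ ∧
          ω =ᵐ[μM] kernApply κ ω₀) ∧ energy ω = energy ω₀}) :
    S.Nonempty ∧ ∃ ωstar ∈ S, ∀ ω ∈ S,
      ∫ x, f (ωstar x) ∂μM ≤ ∫ x, f (ω x) ∂μM := by
  subst hS
  obtain ⟨C, hC⟩ : ∃ C : ℝ, ∀ᵐ x ∂μM, |ω₀ x| ≤ C :=
    ⟨_, ae_le_lpNorm_exponent_top hω₀⟩
  have hbound : ∀ {κ : Kernel (ℝ × ℝ) (ℝ × ℝ)} {ω : ℝ × ℝ → ℝ}, IsBistochastic μM κ →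
      ω =ᵐ[μM] kernApply κ ω₀ → ∀ᵐ x ∂μM, |ω x| ≤ C := by
    intro κ ω hκ h
    filter_upwards [h, hκ.ae_abs_kernApply_le hC] with x hx hx'
    rwa [hx]
  have hne : ω₀ ∈ {ω | MemLp ω ⊤ μM ∧
      (∃ κ : Kernel (ℝ × ℝ) (ℝ × ℝ), IsBistochastic μM κ ∧
        ω =ᵐ[μM] kernApply κ ω₀) ∧ energy ω = energy ω₀} := by
    refine ⟨hω₀, ⟨Kernel.id, isBistochastic_id μM, Filter.Eventually.of_forall fun x => ?_⟩, rfl⟩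
    simp [kernApply, Kernel.id_apply]
  refine ⟨⟨ω₀, hne⟩, ?_⟩
  set S := {ω | MemLp ω ⊤ μM ∧
      (∃ κ : Kernel (ℝ × ℝ) (ℝ × ℝ), IsBistochastic μM κ ∧
        ω =ᵐ[μM] kernApply κ ω₀) ∧ energy ω = energy ω₀} with hS
  set J : (ℝ × ℝ → ℝ) → ℝ := fun ω => ∫ x, f (ω x) ∂μM with hJ
  have hbdd : BddBelow (J '' S) := by
    obtain ⟨B, hB⟩ := (isCompact_Icc (a := -C) (b := C)).exists_bound_of_continuousOn
      hfc.continuousOn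
    refine ⟨-(B * μM.real Set.univ), ?_⟩
    rintro _ ⟨ω, ⟨-, ⟨κ, hκ, hωκ⟩, -⟩, rfl⟩
    have h : ‖∫ x, f (ω x) ∂μM‖ ≤ B * μM.real Set.univ := by
      refine norm_integral_le_of_norm_le_const ?_
      filter_upwards [hbound hκ hωκ] with x hx
      exact hB _ (abs_le.1 hx)
    exact (abs_le.1 h).1
  obtain ⟨u, -, hu, huS⟩ := exists_seq_tendsto_sInf (Set.Nonempty.image J ⟨ω₀, hne⟩) hbdd
  choose η hηS hηu using huS
  choose hηm hηκ hηE using hηS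
  choose κ hκ hκη using hηκ
  obtain ⟨κ', s, hs, hκ', hlim⟩ := exists_bistochastic_limit hκ hω₀.1 hC
  have hm : ∀ n, AEStronglyMeasurable (η (s n)) μM := fun n => (hηm (s n)).1
  have hm' := hκ'.aestronglyMeasurable_kernApply hω₀.1
  have hb : ∀ n, ∀ᵐ x ∂μM, |η (s n) x| ≤ C := fun n => hbound (hκ _) (hκη _)
  have hb' := hκ'.ae_abs_kernApply_le hC
  have hlim' : ∀ φ : ℝ × ℝ → ℂ, Integrable φ μM → Filter.Tendsto
      (fun n => ∫ x, φ x * (η (s n) x : ℂ) ∂μM) Filter.atTop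
      (nhds (∫ x, φ x * (kernApply κ' ω₀ x : ℂ) ∂μM)) := by
    intro φ hφ
    refine (hlim φ hφ).congr fun n => integral_congr_ae ?_
    filter_upwards [hκη (s n)] with x hx
    rw [hx]
  have hE := tendsto_energy hm hm' hb hb' hlim'
  simp only [hηE] at hE
  refine ⟨kernApply κ' ω₀, ⟨hκ'.memLp_top_kernApply hω₀.1 hC,
    ⟨κ', hκ', Filter.EventuallyEq.rfl⟩, tendsto_nhds_unique hE tendsto_const_nhds |>.symm ▸ rfl⟩,
    fun ω hω => ?_⟩
  have hu' : Filter.Tendsto (fun n => ∫ x, f (η (s n) x) ∂μM) Filter.atTop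
      (nhds (sInf (J '' S))) :=
    (hu.comp hs.tendsto_atTop).congr fun n => (hηu (s n)).symm
  exact (integral_comp_le_of_weak_limit hfc hfconv.convexOn hm hm' hb hb' hlim' hu').trans
    (csInf_le hbdd ⟨ω, hω, rfl⟩)

end
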